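/- Let (W,S) be a Coxeter system and fix a reflection t ∈ T. Let X_t be the graph obtained from the right Cayley graph X(W,S) by deleting every edge {w, ws} (w ∈ W, s ∈ S) with wsw⁻¹ = t. Then X_t has exactly two connected components, namely the two nonempty sets {w ∈ W : ℓ(tw) > ℓ(w)} and {w ∈ W : ℓ(tw) < ℓ(w)}; moreover every deleted edge has one endpoint in each of these two components. -/

import Mathlib

open CoxeterSystem

variable {B W : Type*} [Group W] {M : CoxeterMatrix B}

/-- One step in the graph `X_t` obtained from the right Cayley graph `X(W,S)` by deleting
all edges `{w, ws}` with `w s w⁻¹ = t`.  (This step relation is symmetric.) -/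
def DelStep (cs : CoxeterSystem M W) (t : W) (u v : W) : Prop :=
  ∃ i : B, v = u * cs.simple i ∧ u * cs.simple i * u⁻¹ ≠ t

open Classical in
/-- The involution `(r, ε) ↦ (s r s⁻¹, ε + [r = s])` of `W × ZMod 2` attached to an involution
`s` of a group. -/
noncomputable def signedConj {G : Type*} [Group G] (s : G) (hs : s * s = 1) :
    Equiv.Perm (G × ZMod 2) :=
  Function.Involutive.toPerm
    (fun p ↦ (s * p.1 * s⁻¹, p.2 + if p.1 = s then 1 else 0)) <| by
      rintro ⟨r, ε⟩
      have hinv : s⁻¹ = s := inv_eq_of_mul_eq_one_right hs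
      have hiff : s * r * s⁻¹ = s ↔ r = s := by
        rw [mul_inv_eq_iff_eq_mul, mul_right_inj]
      simp only [hiff, Prod.mk.injEq]
      constructor
      · rw [hinv, show s * (s * r * s) * s = (s * s) * r * (s * s) by group, hs]
        simp
      · split_ifs
        · rw [add_assoc, CharTwo.add_self_eq_zero, add_zero]
        · simp

open Classical in
theorem signedConj_apply {G : Type*} [Group G] (s : G) (hs : s * s = 1) (r : G) (ε : ZMod 2) :
    signedConj s hs (r, ε) = (s * r * s⁻¹, ε + if r = s then 1 else 0) := rfl

open Classical in
theorem signedConj_mul_pow_apply {G : Type*} [Group G] (a b : G) (ha : a * a = 1)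
    (hb : b * b = 1) (k : ℕ) (r : G) (ε : ZMod 2) :
    ((signedConj a ha * signedConj b hb) ^ k) (r, ε) =
      ((a * b) ^ k * r * ((a * b) ^ k)⁻¹,
        ε + ∑ n ∈ Finset.range (2 * k), if r = (b * a) ^ n * b then 1 else 0) := by
  have hai : a⁻¹ = a := inv_eq_of_mul_eq_one_right ha
  have hbi : b⁻¹ = b := inv_eq_of_mul_eq_one_right hb
  induction k with
  | zero => simp
  | succ k ih =>
    have hinv : ((a * b) ^ k)⁻¹ = (b * a) ^ k := by
      rw [← inv_pow, mul_inv_rev, hai, hbi]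
    have hcomm : b * (a * b) ^ k = (b * a) ^ k * b :=
      ((SemiconjBy.pow_right (by simp [SemiconjBy, mul_assoc] : SemiconjBy b (a * b) (b * a)) k))
    have h₁ : (a * b) ^ k * r * ((a * b) ^ k)⁻¹ = b ↔ r = (b * a) ^ (2 * k) * b := by
      rw [mul_inv_eq_iff_eq_mul, ← eq_inv_mul_iff_mul_eq, hinv, hcomm, two_mul, pow_add, mul_assoc]
    have h₂ : b * ((a * b) ^ k * r * ((a * b) ^ k)⁻¹) * b⁻¹ = a ↔
        r = (b * a) ^ (2 * k + 1) * b := by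
      rw [mul_inv_eq_iff_eq_mul, ← eq_inv_mul_iff_mul_eq, mul_inv_eq_iff_eq_mul,
        ← eq_inv_mul_iff_mul_eq, hinv, hbi, mul_assoc b, mul_assoc a, hcomm, ← mul_assoc a,
        show b * (a * (b * a) ^ k * b) = (b * a) * ((b * a) ^ k * b) by group, ← mul_assoc (b * a),
        ← pow_succ', ← mul_assoc, ← pow_add]
      ring_nf
    rw [pow_succ', Equiv.Perm.mul_apply, ih, Equiv.Perm.mul_apply, signedConj_apply,
      signedConj_apply, show 2 * (k + 1) = 2 * k + 1 + 1 by ring, Finset.sum_range_succ,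
      Finset.sum_range_succ]
    simp only [h₁, h₂, Prod.mk.injEq]
    constructor
    · simp only [pow_succ' (a * b), mul_inv_rev, mul_assoc]
    · ring

theorem signedConj_mul_pow_eq_one {G : Type*} [Group G] (a b : G) (ha : a * a = 1)
    (hb : b * b = 1) (m : ℕ) (hm : (a * b) ^ m = 1) :
    (signedConj a ha * signedConj b hb) ^ m = 1 := by
  classical
  have hba : (b * a) ^ m = 1 := by
    rw [← inv_inj, ← inv_pow, mul_inv_rev, inv_eq_of_mul_eq_one_right ha,
      inv_eq_of_mul_eq_one_right hb, hm, inv_one]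
  ext1 ⟨r, ε⟩
  rw [signedConj_mul_pow_apply, hm, two_mul, Finset.sum_range_add]
  simp only [pow_add, hba, one_mul]
  rw [CharTwo.add_self_eq_zero]
  simp

namespace CoxeterSystem

/-- The action of `W` on `W × ZMod 2` in which `s` sends `(r, ε)` to `(s r s⁻¹, ε + [r = s])`. -/
noncomputable def signedConjHom (cs : CoxeterSystem M W) : W →* Equiv.Perm (W × ZMod 2) :=
  cs.lift ⟨fun i ↦ signedConj (cs.simple i) (cs.simple_mul_simple_self i), fun i j ↦
    signedConj_mul_pow_eq_one _ _ _ _ _ (cs.simple_mul_simple_pow i j)⟩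

theorem signedConjHom_simple (cs : CoxeterSystem M W) (i : B) :
    cs.signedConjHom (cs.simple i) = signedConj (cs.simple i) (cs.simple_mul_simple_self i) :=
  cs.lift_apply_simple _ i

/-- The parity of the number of occurrences of `r` in the right inversion sequence of any word
for `w`. -/
noncomputable def inversionParity (cs : CoxeterSystem M W) (w r : W) : ZMod 2 :=
  (cs.signedConjHom w (r, 0)).2

theorem signedConjHom_apply (cs : CoxeterSystem M W) (w r : W) (ε : ZMod 2) :
    cs.signedConjHom w (r, ε) = (w * r * w⁻¹, ε + cs.inversionParity w r) := by
  classical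
  unfold inversionParity
  induction w using cs.simple_induction_left generalizing r ε with
  | one => simp
  | mul_simple_left w i ih =>
    simp only [map_mul, Equiv.Perm.mul_apply]
    rw [ih r ε, ih r 0, signedConjHom_simple, signedConj_apply, signedConj_apply]
    simp only [Prod.mk.injEq]
    constructor
    · group
    · ring

theorem inversionParity_one (cs : CoxeterSystem M W) (r : W) : cs.inversionParity 1 r = 0 := by
  simp [inversionParity]

theorem inversionParity_mul (cs : CoxeterSystem M W) (u v r : W) :
    cs.inversionParity (u * v) r =
      cs.inversionParity v r + cs.inversionParity u (v * r * v⁻¹) := by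
  have h := cs.signedConjHom_apply (u * v) r 0
  rw [map_mul, Equiv.Perm.mul_apply, signedConjHom_apply, signedConjHom_apply] at h
  simpa using (congrArg Prod.snd h).symm

open Classical in
theorem inversionParity_simple (cs : CoxeterSystem M W) (i : B) (r : W) :
    cs.inversionParity (cs.simple i) r = if r = cs.simple i then 1 else 0 := by
  rw [inversionParity, signedConjHom_simple, signedConj_apply]
  simp

theorem mem_rightInvSeq_of_inversionParity_ne_zero (cs : CoxeterSystem M W) (ω : List B) (r : W)
    (h : cs.inversionParity (cs.wordProd ω) r ≠ 0) : r ∈ cs.rightInvSeq ω := by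
  classical
  induction ω with
  | nil => simp [inversionParity_one] at h
  | cons i ω ih =>
    rw [rightInvSeq, List.mem_cons]
    rw [wordProd_cons, inversionParity_mul, inversionParity_simple] at h
    by_cases hr : cs.wordProd ω * r * (cs.wordProd ω)⁻¹ = cs.simple i
    · left
      rw [← hr]; group
    · right
      rw [if_neg hr, add_zero] at h
      exact ih h

theorem IsReflection.inversionParity_self {cs : CoxeterSystem M W} {t : W}
    (ht : cs.IsReflection t) : cs.inversionParity t t = 1 := by
  obtain ⟨w, i, rfl⟩ := ht
  have h := cs.inversionParity_mul w w⁻¹ (w * cs.simple i * w⁻¹)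
  have e : w⁻¹ * (w * cs.simple i * w⁻¹) * w⁻¹⁻¹ = cs.simple i := by group
  rw [mul_inv_cancel, inversionParity_one, e] at h
  rw [inversionParity_mul, inversionParity_mul, e, inversionParity_simple, if_pos rfl,
    mul_inv_cancel_right, add_left_comm, add_comm 1, add_comm]
  linear_combination -h

theorem IsReflection.length_mul_lt_iff {cs : CoxeterSystem M W} {t : W}
    (ht : cs.IsReflection t) (w : W) :
    cs.length (t * w) < cs.length w ↔ cs.inversionParity w⁻¹ t = 1 := by
  have key (v : W) (hv : cs.inversionParity v⁻¹ t = 1) : cs.length (t * v) < cs.length v := by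
    obtain ⟨ω, hω, hvω⟩ := cs.exists_isReduced v⁻¹
    have hmem := cs.mem_rightInvSeq_of_inversionParity_ne_zero ω t (by rw [← hvω, hv]; decide)
    have hlt := (cs.isRightInversion_of_mem_rightInvSeq hω hmem).2
    rw [← hvω, length_inv, ← length_inv, mul_inv_rev, inv_inv, ht.inv] at hlt
    exact hlt
  refine ⟨fun h ↦ ?_, key w⟩
  by_contra hw
  have h0 : cs.inversionParity w⁻¹ t = 0 := by
    generalize cs.inversionParity w⁻¹ t = z at hw ⊢
    revert z; decide
  have := key (t * w) (by
    rw [mul_inv_rev, ht.inv, inversionParity_mul, ht.inversionParity_self, mul_inv_cancel_right,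
      h0, add_zero])
  rw [← mul_assoc, ht.mul_self, one_mul] at this
  omega

theorem IsReflection.length_lt_mul_iff {cs : CoxeterSystem M W} {t : W}
    (ht : cs.IsReflection t) (w : W) :
    cs.length w < cs.length (t * w) ↔ ¬ cs.length (t * w) < cs.length w := by
  have := ht.length_mul_right_ne w
  omega

theorem IsReflection.length_mul_mul_simple_lt_iff {cs : CoxeterSystem M W} {t : W}
    (ht : cs.IsReflection t) (w : W) (i : B) :
    (cs.length (t * (w * cs.simple i)) < cs.length (w * cs.simple i) ↔
      cs.length (t * w) < cs.length w) ↔ w * cs.simple i * w⁻¹ ≠ t := by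
  classical
  have e : w⁻¹ * t * w⁻¹⁻¹ = cs.simple i ↔ w * cs.simple i * w⁻¹ = t := by
    rw [mul_inv_eq_iff_eq_mul, inv_mul_eq_iff_eq_mul, ← mul_assoc, eq_comm]
  rw [ht.length_mul_lt_iff, ht.length_mul_lt_iff, mul_inv_rev, inv_simple, inversionParity_mul,
    inversionParity_simple, ne_eq, ← e]
  generalize cs.inversionParity w⁻¹ t = z
  by_cases h : w⁻¹ * t * w⁻¹⁻¹ = cs.simple i
  · simp only [h, if_true]
    revert z; decide
  · simp only [h, if_false, add_zero, not_false_eq_true]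

end CoxeterSystem

theorem DelStep.symm {cs : CoxeterSystem M W} {t u v : W} (h : DelStep cs t u v) :
    DelStep cs t v u := by
  obtain ⟨i, rfl, hne⟩ := h
  refine ⟨i, by simp, ?_⟩
  simpa [mul_assoc] using hne

theorem DelStep.reflection_mul {cs : CoxeterSystem M W} {t u v : W} (h : DelStep cs t u v) :
    DelStep cs t (t * u) (t * v) := by
  obtain ⟨i, rfl, hne⟩ := h
  refine ⟨i, (mul_assoc _ _ _).symm, fun h ↦ hne ?_⟩
  have : t * (u * cs.simple i * u⁻¹) * t⁻¹ = t := by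
    simpa [mul_assoc] using h
  rwa [mul_inv_eq_iff_eq_mul, mul_right_inj] at this

theorem DelStep.length_mul_lt_iff {cs : CoxeterSystem M W} {t u v : W}
    (ht : cs.IsReflection t) (h : DelStep cs t u v) :
    cs.length (t * v) < cs.length v ↔ cs.length (t * u) < cs.length u := by
  obtain ⟨i, rfl, hne⟩ := h
  exact (ht.length_mul_mul_simple_lt_iff u i).2 hne

theorem reflTransGen_delStep_one {cs : CoxeterSystem M W} {t : W} (ht : cs.IsReflection t)
    (x : W) (hx : cs.length x < cs.length (t * x)) :
    Relation.ReflTransGen (DelStep cs t) x 1 := by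
  induction hn : cs.length x using Nat.strong_induction_on generalizing x with
  | _ n ih =>
    by_cases h1 : x = 1
    · rw [h1]
    obtain ⟨i, hi⟩ := cs.exists_rightDescent_of_ne_one h1
    have hi' : cs.length (x * cs.simple i) < cs.length x := hi
    have hstep : DelStep cs t x (x * cs.simple i) := by
      refine ⟨i, rfl, fun h ↦ ?_⟩
      rw [← h, inv_mul_cancel_right] at hx
      omega
    refine .head hstep (ih _ (hn ▸ hi') _ ?_ rfl)
    rw [ht.length_lt_mul_iff] at hx ⊢
    rwa [hstep.length_mul_lt_iff ht]

theorem reflTransGen_delStep_symm {cs : CoxeterSystem M W} {t x y : W}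
    (h : Relation.ReflTransGen (DelStep cs t) x y) : Relation.ReflTransGen (DelStep cs t) y x :=
  have : Std.Symm (DelStep cs t) := ⟨fun _ _ ↦ DelStep.symm⟩
  symm h

theorem reflTransGen_delStep_reflection {cs : CoxeterSystem M W} {t : W} (ht : cs.IsReflection t)
    (x : W) (hx : cs.length (t * x) < cs.length x) :
    Relation.ReflTransGen (DelStep cs t) x t := by
  have h := (reflTransGen_delStep_one ht (t * x) (by
    rwa [← mul_assoc, ht.mul_self, one_mul])).lift (t * ·) fun _ _ ↦ DelStep.reflection_mul
  simpa [Function.onFun, ← mul_assoc, ht.mul_self] using h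

/-- deleting from the Cayley graph all edges `{w, ws}` with `w s w⁻¹ = t`
leaves exactly two connected components, namely `{w : ℓ(tw) > ℓ(w)}` and
`{w : ℓ(tw) < ℓ(w)}` (both nonempty); moreover every deleted edge has one endpoint in
each component. -/
theorem stmt19 (cs : CoxeterSystem M W) (t : W) (ht : cs.IsReflection t) :
    {w : W | cs.length w < cs.length (t * w)}.Nonempty ∧
    {w : W | cs.length (t * w) < cs.length w}.Nonempty ∧
    (∀ x y : W, Relation.ReflTransGen (DelStep cs t) x y ↔
      ((cs.length x < cs.length (t * x) ∧ cs.length y < cs.length (t * y)) ∨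
        (cs.length (t * x) < cs.length x ∧ cs.length (t * y) < cs.length y))) ∧
    (∀ (w : W) (i : B), w * cs.simple i * w⁻¹ = t →
      ((cs.length w < cs.length (t * w) ∧
          cs.length (t * (w * cs.simple i)) < cs.length (w * cs.simple i)) ∨
        (cs.length (t * w) < cs.length w ∧
          cs.length (w * cs.simple i) < cs.length (t * (w * cs.simple i))))) := by
  have h1 : cs.length 1 < cs.length (t * 1) := by
    have := ht.length_mul_right_ne 1
    simp only [length_one] at this ⊢
    omega
  refine ⟨⟨1, h1⟩, ⟨t, ?_⟩, fun x y ↦ ⟨fun h ↦ ?_, ?_⟩, fun w i h ↦ ?_⟩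
  · rw [Set.mem_ofPred_eq, ht.mul_self]
    simpa using h1
  · have hxy : cs.length (t * y) < cs.length y ↔ cs.length (t * x) < cs.length x := by
      induction h with
      | refl => rfl
      | tail _ hstep ih => exact (hstep.length_mul_lt_iff ht).trans ih
    rw [ht.length_lt_mul_iff, ht.length_lt_mul_iff, hxy]
    tauto
  · rintro (⟨hx, hy⟩ | ⟨hx, hy⟩)
    · exact (reflTransGen_delStep_one ht x hx).trans
        (reflTransGen_delStep_symm (reflTransGen_delStep_one ht y hy))
    · exact (reflTransGen_delStep_reflection ht x hx).trans
        (reflTransGen_delStep_symm (reflTransGen_delStep_reflection ht y hy))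
  · have := ht.length_mul_mul_simple_lt_iff w i
    rw [ht.length_lt_mul_iff, ht.length_lt_mul_iff]
    tauto
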